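/- Let u : ℂ → ℝ be smooth, λ ∈ ℂ\{0}, and let (ψ₁, ψ₂) solve system (Ψ_λ). Then the product ψ₁ψ₂ lies in the kernel of the Jacobi operator: ∂̄∂(ψ₁ψ₂) + cosh(2u)·ψ₁ψ₂ = 0 holds identically on ℂ. Moreover, if in addition ψ₁ and ψ₂ satisfy ψᵢ(z + γ) = μ ψᵢ(z) for all z ∈ ℂ, for some γ ∈ ℂ and μ ∈ ℂ, then (ψ₁ψ₂)(z + γ) = μ² (ψ₁ψ₂)(z) for all z. -/

import Mathlib

noncomputable section

open Complex Matrix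

/-- Wirtinger derivative `∂f = (1/2)(f_x - i f_y)`. -/
def wd (f : ℂ → ℂ) (z : ℂ) : ℂ :=
  (fderiv ℝ f z 1 - Complex.I * fderiv ℝ f z Complex.I) / 2

/-- Conjugate Wirtinger derivative `∂̄f = (1/2)(f_x + i f_y)`. -/
def wdb (f : ℂ → ℂ) (z : ℂ) : ℂ :=
  (fderiv ℝ f z 1 + Complex.I * fderiv ℝ f z Complex.I) / 2

/-- Complexification of a real-valued function. -/
def cx (u : ℂ → ℝ) : ℂ → ℂ := fun z => (u z : ℂ)

/-- Entrywise Wirtinger derivative of a matrix-valued function. -/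
def mwd (F : ℂ → Matrix (Fin 2) (Fin 2) ℂ) (z : ℂ) : Matrix (Fin 2) (Fin 2) ℂ :=
  Matrix.of fun i j => wd (fun w => F w i j) z

/-- Entrywise conjugate Wirtinger derivative of a matrix-valued function. -/
def mwdb (F : ℂ → Matrix (Fin 2) (Fin 2) ℂ) (z : ℂ) : Matrix (Fin 2) (Fin 2) ℂ :=
  Matrix.of fun i j => wdb (fun w => F w i j) z

/-- Entrywise Wirtinger derivative of a vector-valued function. -/
def vwd (v : ℂ → Fin 2 → ℂ) (z : ℂ) : Fin 2 → ℂ := fun i => wd (fun w => v w i) z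

/-- Entrywise conjugate Wirtinger derivative of a vector-valued function. -/
def vwdb (v : ℂ → Fin 2 → ℂ) (z : ℂ) : Fin 2 → ℂ := fun i => wdb (fun w => v w i) z

/-- `u` solves the sinh-Gordon equation `∂∂̄u + (1/2) sinh (2u) = 0`. -/
def SinhGordon (u : ℂ → ℝ) : Prop :=
  ∀ z, wd (wdb (cx u)) z + (1/2) * Complex.sinh (2 * (u z : ℂ)) = 0

/-- `(ψ₁, ψ₂)` solves the system `(Ψ_λ)`. -/
def SolPsi (u : ℂ → ℝ) (lam : ℂ) (p1 p2 : ℂ → ℂ) : Prop :=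
  ContDiff ℝ (⊤ : ℕ∞) p1 ∧ ContDiff ℝ (⊤ : ℕ∞) p2 ∧
  (∀ z, wd p1 z = (1/2) * (wd (cx u) z * p1 z
      + Complex.I * Complex.exp (-(u z : ℂ)) * p2 z)) ∧
  (∀ z, wd p2 z = (1/2) * (Complex.I * lam⁻¹ * Complex.exp ((u z : ℂ)) * p1 z
      - wd (cx u) z * p2 z)) ∧
  (∀ z, wdb p1 z = (1/2) * (-(wdb (cx u) z) * p1 z
      + Complex.I * lam * Complex.exp ((u z : ℂ)) * p2 z)) ∧
  (∀ z, wdb p2 z = (1/2) * (Complex.I * Complex.exp (-(u z : ℂ)) * p1 z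
      + wdb (cx u) z * p2 z))

/-- `(φ₁, φ₂)` solves the system `(Φ_λ)`. -/
def SolPhi (u : ℂ → ℝ) (lam : ℂ) (f1 f2 : ℂ → ℂ) : Prop :=
  ContDiff ℝ (⊤ : ℕ∞) f1 ∧ ContDiff ℝ (⊤ : ℕ∞) f2 ∧
  (∀ z, wd f1 z = -(1/2) * (wd (cx u) z * f1 z
      + Complex.I * lam⁻¹ * Complex.exp ((u z : ℂ)) * f2 z)) ∧
  (∀ z, wd f2 z = -(1/2) * (Complex.I * Complex.exp (-(u z : ℂ)) * f1 z
      - wd (cx u) z * f2 z)) ∧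
  (∀ z, wdb f1 z = -(1/2) * (-(wdb (cx u) z) * f1 z
      + Complex.I * Complex.exp (-(u z : ℂ)) * f2 z)) ∧
  (∀ z, wdb f2 z = -(1/2) * (Complex.I * lam * Complex.exp ((u z : ℂ)) * f1 z
      + wdb (cx u) z * f2 z))

/-- The matrix `A_λ = (1/2) [[∂u, iλ⁻¹e^u], [ie^{-u}, -∂u]]`. -/
def matA (u : ℂ → ℝ) (lam : ℂ) (z : ℂ) : Matrix (Fin 2) (Fin 2) ℂ :=
  ((1:ℂ)/2) • !![wd (cx u) z, Complex.I * lam⁻¹ * Complex.exp ((u z : ℂ));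
    Complex.I * Complex.exp (-(u z : ℂ)), -(wd (cx u) z)]

/-- The matrix `B_λ = (1/2) [[-∂̄u, ie^{-u}], [iλe^u, ∂̄u]]`. -/
def matB (u : ℂ → ℝ) (lam : ℂ) (z : ℂ) : Matrix (Fin 2) (Fin 2) ℂ :=
  ((1:ℂ)/2) • !![-(wdb (cx u) z), Complex.I * Complex.exp (-(u z : ℂ));
    Complex.I * lam * Complex.exp ((u z : ℂ)), wdb (cx u) z]

/-- Leibniz rule for the Wirtinger derivative. -/
theorem wd_mul {f g : ℂ → ℂ} {z : ℂ} (hf : DifferentiableAt ℝ f z)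
    (hg : DifferentiableAt ℝ g z) :
    wd (fun w => f w * g w) z = wd f z * g z + f z * wd g z := by
  simp only [wd, fderiv_fun_mul hf hg, _root_.add_apply,
    _root_.smul_apply, smul_eq_mul]
  ring

/-- Leibniz rule for the conjugate Wirtinger derivative. -/
theorem wdb_mul {f g : ℂ → ℂ} {z : ℂ} (hf : DifferentiableAt ℝ f z)
    (hg : DifferentiableAt ℝ g z) :
    wdb (fun w => f w * g w) z = wdb f z * g z + f z * wdb g z := by
  simp only [wdb, fderiv_fun_mul hf hg, _root_.add_apply,
    _root_.smul_apply, smul_eq_mul]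
  ring

theorem wdb_add {f g : ℂ → ℂ} {z : ℂ} (hf : DifferentiableAt ℝ f z)
    (hg : DifferentiableAt ℝ g z) :
    wdb (fun w => f w + g w) z = wdb f z + wdb g z := by
  simp only [wdb, fderiv_fun_add hf hg, _root_.add_apply]
  ring

theorem wdb_const_mul {f : ℂ → ℂ} {z : ℂ} (hf : DifferentiableAt ℝ f z) (c : ℂ) :
    wdb (fun w => c * f w) z = c * wdb f z := by
  simp only [wdb, fderiv_const_mul hf, _root_.smul_apply, smul_eq_mul]
  ring

theorem wdb_neg (f : ℂ → ℂ) (z : ℂ) : wdb (fun w => -f w) z = -wdb f z := by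
  simp only [wdb, fderiv_fun_neg, _root_.neg_apply]
  ring

theorem wdb_cexp {f : ℂ → ℂ} {z : ℂ} (hf : DifferentiableAt ℝ f z) :
    wdb (fun w => Complex.exp (f w)) z = Complex.exp (f z) * wdb f z := by
  simp only [wdb, hf.hasFDerivAt.cexp.fderiv, _root_.smul_apply, smul_eq_mul]
  ring

/-- The first-order equations express `∂(ψ₁ψ₂)` without derivatives. -/
theorem SolPsi.wd_mul {u : ℂ → ℝ} {lam : ℂ} {p1 p2 : ℂ → ℂ} (h : SolPsi u lam p1 p2) (z : ℂ) :
    wd (fun w => p1 w * p2 w) z =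
      Complex.I / 2 * (Complex.exp (-cx u z) * (p2 z * p2 z)
        + lam⁻¹ * (Complex.exp (cx u z) * (p1 z * p1 z))) := by
  obtain ⟨h1, h2, e1, e2, -, -⟩ := h
  rw [_root_.wd_mul (h1.differentiable (by simp) z) (h2.differentiable (by simp) z), e1, e2]
  simp only [cx]
  ring

/-- `ψ₁ψ₂` lies in the kernel of the Jacobi operator, and has
multiplier `μ²` whenever `ψ₁, ψ₂` have multiplier `μ`. -/
theorem statement14 (u : ℂ → ℝ) (hu : ContDiff ℝ (⊤ : ℕ∞) u) (lam : ℂ) (hlam : lam ≠ 0)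
    (p1 p2 : ℂ → ℂ) (hpsi : SolPsi u lam p1 p2) :
    (∀ z, wdb (wd (fun w => p1 w * p2 w)) z
        + Complex.cosh (2 * (u z : ℂ)) * (p1 z * p2 z) = 0) ∧
    (∀ γ μ : ℂ, (∀ z, p1 (z + γ) = μ * p1 z) → (∀ z, p2 (z + γ) = μ * p2 z) →
      ∀ z, p1 (z + γ) * p2 (z + γ) = μ ^ 2 * (p1 z * p2 z)) := by
  have hu' : Differentiable ℝ (cx u) := fun z =>
    Complex.ofRealCLM.differentiableAt.comp z (hu.differentiable (by simp) z)
  have h1 : Differentiable ℝ p1 := hpsi.1.differentiable (by simp)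
  have h2 : Differentiable ℝ p2 := hpsi.2.1.differentiable (by simp)
  refine ⟨fun z => ?_, fun γ μ hp1 hp2 z => by rw [hp1, hp2]; ring⟩
  have hneg : DifferentiableAt ℝ (fun w => -cx u w) z := (hu' z).fun_neg
  have hp1 := (h1 z).fun_mul (h1 z)
  have hp2 := (h2 z).fun_mul (h2 z)
  have hprod : DifferentiableAt ℝ (fun w => Complex.exp (cx u w) * (p1 w * p1 w)) z :=
    (hu' z).cexp.fun_mul hp1
  have hcosh : Complex.cosh (2 * (u z : ℂ)) =
      (Complex.exp (cx u z) ^ 2 + Complex.exp (-cx u z) ^ 2) / 2 := by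
    rw [Complex.cosh, ← Complex.exp_nat_mul, ← Complex.exp_nat_mul]
    simp [cx]
  have hwd := funext hpsi.wd_mul
  obtain ⟨-, -, -, -, e3, e4⟩ := hpsi
  rw [hwd,
    wdb_const_mul ((hneg.cexp.fun_mul hp2).fun_add (hprod.const_mul _)),
    wdb_add (hneg.cexp.fun_mul hp2) (hprod.const_mul _), wdb_const_mul hprod,
    wdb_mul hneg.cexp hp2, wdb_mul (hu' z).cexp hp1, wdb_mul (h1 z) (h1 z),
    wdb_mul (h2 z) (h2 z), wdb_cexp hneg, wdb_cexp (hu' z), wdb_neg, e3, e4, hcosh]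
  simp only [cx]
  field_simp
  ring_nf
  simp only [Complex.I_sq]
  ring
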